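/- Let w be a positive superharmonic function on 𝔻 with inf_{z∈𝔻} w(z) = 0. Then there exist a point a ∈ ℂ with |a| = 1 and a sequence (aₙ) in 𝔻 with aₙ → a such that, setting h(z) := z(a − z) and φₙ(z) := (aₙ − z)/(1 − \bar{aₙ} z), one has ‖h∘φₙ‖²_{𝒟_w} = ‖h∘φₙ‖²_{H²} + D_w(h∘φₙ) → 0 as n → ∞; here h is bounded, non-constant, h(0) = 0, and each φₙ is a holomorphic automorphism of 𝔻. -/

import Mathlib

open Complex MeasureTheory Metric Set Filter

/-- `w : ℂ → ℝ` is superharmonic on the open unit disk: it is lower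
semicontinuous there and satisfies the super-mean-value inequality on every
closed disk contained in `𝔻`. -/
def SuperharmonicOnDisk (w : ℂ → ℝ) : Prop :=
  LowerSemicontinuousOn w (Metric.ball 0 1) ∧
    ∀ z₀ ∈ Metric.ball (0 : ℂ) 1, ∀ r > (0 : ℝ),
      Metric.closedBall z₀ r ⊆ Metric.ball 0 1 →
      (1 / (2 * Real.pi)) * ∫ θ in (0 : ℝ)..(2 * Real.pi),
          w (z₀ + r * Complex.exp (θ * Complex.I)) ≤ w z₀

/-- The squared `H²` norm of `f`, expressed via its Taylor coefficients at `0`: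
`‖f‖²_{H²} = ∑_{n≥0} |aₙ|²` where `aₙ = f⁽ⁿ⁾(0)/n!`. -/
noncomputable def hardyNormSq (f : ℂ → ℂ) : ℝ :=
  ∑' n : ℕ, ‖iteratedDeriv n f 0 / (Nat.factorial n : ℂ)‖ ^ 2

/-- The involutive automorphism `z ↦ (α - z) / (1 - conj α * z)` of the unit disk. -/
noncomputable def diskInvolution (α z : ℂ) : ℂ := (α - z) / (1 - (starRingEnd ℂ) α * z)

section DiskInvolution

variable {α z : ℂ}

theorem one_sub_conj_mul_ne_zero (hα : ‖α‖ < 1) (hz : ‖z‖ ≤ 1) :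
    1 - (starRingEnd ℂ) α * z ≠ 0 := by
  intro h
  have h1 : ‖(starRingEnd ℂ) α * z‖ = 1 := by rw [← sub_eq_zero.mp h, norm_one]
  rw [norm_mul, RCLike.norm_conj] at h1
  nlinarith [norm_nonneg α, norm_nonneg z]

theorem norm_diskInvolution_lt_one (hα : ‖α‖ < 1) (hz : ‖z‖ < 1) :
    ‖diskInvolution α z‖ < 1 := by
  have h0 := one_sub_conj_mul_ne_zero hα hz.le
  rw [diskInvolution, norm_div, div_lt_one (norm_pos_iff.mpr h0)]
  have key : ‖1 - (starRingEnd ℂ) α * z‖ ^ 2 - ‖α - z‖ ^ 2 =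
      (1 - ‖α‖ ^ 2) * (1 - ‖z‖ ^ 2) := by
    simp only [← Complex.normSq_eq_norm_sq, Complex.normSq_apply, Complex.sub_re, Complex.sub_im,
      Complex.mul_re, Complex.mul_im, Complex.conj_re, Complex.conj_im, Complex.one_re,
      Complex.one_im]
    ring
  have h1 : 0 < (1 - ‖α‖ ^ 2) * (1 - ‖z‖ ^ 2) := by
    apply mul_pos <;> nlinarith [norm_nonneg α, norm_nonneg z]
  exact lt_of_pow_lt_pow_left₀ 2 (norm_nonneg _) (by linarith)

theorem diskInvolution_diskInvolution (hα : ‖α‖ < 1) (hz : ‖z‖ < 1) :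
    diskInvolution α (diskInvolution α z) = z := by
  have h0 := one_sub_conj_mul_ne_zero hα hz.le
  have h1 := one_sub_conj_mul_ne_zero hα (norm_diskInvolution_lt_one hα hz).le
  have h2 : diskInvolution α z * (1 - (starRingEnd ℂ) α * z) = α - z := by
    rw [diskInvolution, div_mul_cancel₀ _ h0]
  generalize diskInvolution α z = y at *
  rw [diskInvolution, div_eq_iff h1]
  linear_combination -h2

@[simp] theorem diskInvolution_zero : diskInvolution α 0 = α := by simp [diskInvolution]

@[simp] theorem diskInvolution_self : diskInvolution α α = 0 := by simp [diskInvolution]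

theorem bijOn_diskInvolution (hα : ‖α‖ < 1) :
    BijOn (diskInvolution α) (ball 0 1) (ball 0 1) := by
  have hm : MapsTo (diskInvolution α) (ball 0 1) (ball 0 1) := fun z hz => by
    simpa using norm_diskInvolution_lt_one hα (by simpa using hz)
  have hi : LeftInvOn (diskInvolution α) (diskInvolution α) (ball 0 1) := fun z hz =>
    diskInvolution_diskInvolution hα (by simpa using hz)
  exact InvOn.bijOn ⟨hi, hi⟩ hm hm

theorem differentiableAt_diskInvolution (hα : ‖α‖ < 1) (hz : ‖z‖ ≤ 1) :
    DifferentiableAt ℂ (diskInvolution α) z := by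
  unfold diskInvolution
  exact DifferentiableAt.div (by fun_prop) (by fun_prop) (one_sub_conj_mul_ne_zero hα hz)

theorem deriv_diskInvolution_ne_zero (hα : ‖α‖ < 1) (hz : ‖z‖ < 1) :
    deriv (diskInvolution α) z ≠ 0 := by
  intro h
  have h1 : (fun z => diskInvolution α (diskInvolution α z)) =ᶠ[nhds z] id := by
    filter_upwards [isOpen_ball.mem_nhds (show z ∈ ball 0 1 by simpa using hz)] with y hy
    exact diskInvolution_diskInvolution hα (by simpa using hy)
  have h2 := h1.deriv_eq
  have h3 : deriv (fun z => diskInvolution α (diskInvolution α z)) z =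
      deriv (diskInvolution α) (diskInvolution α z) * deriv (diskInvolution α) z :=
    deriv_comp z (differentiableAt_diskInvolution hα (norm_diskInvolution_lt_one hα hz).le)
      (differentiableAt_diskInvolution hα hz.le)
  rw [h3, h] at h2
  simp at h2

theorem continuousOn_diskInvolution (hα : ‖α‖ < 1) :
    ContinuousOn (diskInvolution α) (ball 0 1) := fun z hz =>
  (differentiableAt_diskInvolution hα
    (by simpa using (mem_ball_zero_iff.mp hz).le)).continuousAt.continuousWithinAt

theorem lintegral_ball_deriv_sq_mul (hα : ‖α‖ < 1) (f : ℂ → ENNReal) :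
    ∫⁻ z in ball (0 : ℂ) 1, ENNReal.ofReal (‖deriv (diskInvolution α) z‖ ^ 2) * f z =
      ∫⁻ z in ball (0 : ℂ) 1, f (diskInvolution α z) := by
  have hb := bijOn_diskInvolution hα
  have h := lintegral_image_eq_lintegral_abs_det_fderiv_mul volume
    (measurableSet_ball (x := (0 : ℂ)) (ε := 1)) (f := diskInvolution α)
    (f' := fun z => (ContinuousLinearMap.toSpanSingleton ℂ
      (deriv (diskInvolution α) z)).restrictScalars ℝ)
    (fun z hz => ((differentiableAt_diskInvolution hα
      (by simpa using (mem_ball_zero_iff.mp hz).le)).hasDerivAt.hasFDerivAt.restrictScalars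
        ℝ).hasFDerivWithinAt) hb.injOn (fun z => f (diskInvolution α z))
  rw [hb.image_eq] at h
  rw [h]
  refine setLIntegral_congr_fun measurableSet_ball fun z hz => ?_
  simp only [diskInvolution_diskInvolution hα (mem_ball_zero_iff.mp hz)]
  congr 2
  simp [ContinuousLinearMap.det, LinearMap.det_restrictScalars, Algebra.norm_complex_apply,
    Complex.normSq_eq_norm_sq]

end DiskInvolution

theorem LowerSemicontinuousOn.measurable_indicator {w : ℂ → ℝ} {s : Set ℂ} (hs : IsOpen s)
    (hw : LowerSemicontinuousOn w s) : Measurable (s.indicator w) := by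
  have h1 : Measurable (s.domRestrict w) := by
    refine LowerSemicontinuous.measurable ?_
    intro x y hy
    have := hw x x.2 y hy
    rw [nhdsWithin_eq_map_subtype_coe x.2] at this
    exact this
  exact measurable_of_restrict_of_restrict_compl hs.measurableSet
    (by convert h1 using 1; ext x; simp)
    (by convert measurable_const (a := (0 : ℝ)) using 1; ext x; simpa using fun h => absurd h x.2)

theorem lintegral_ball_polar {g : ℂ → ENNReal} (hg : Measurable g) (R : ℝ) :
    ∫⁻ z in ball (0 : ℂ) R, g z =
      ∫⁻ ρ in Ioo 0 R, ENNReal.ofReal ρ *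
        ∫⁻ θ in Ioo (-Real.pi) Real.pi, g (circleMap 0 ρ θ) := by
  have hm : Measurable fun p : ℝ × ℝ => g (circleMap 0 p.1 p.2) := by
    refine hg.comp (Continuous.measurable ?_)
    simp only [circleMap]
    fun_prop
  rw [← lintegral_indicator measurableSet_ball, ← Complex.lintegral_comp_polarCoord_symm,
    polarCoord_target, Measure.volume_eq_prod, ← Measure.prod_restrict]
  have h1 : ∀ p ∈ Ioi (0 : ℝ) ×ˢ Ioo (-Real.pi) Real.pi,
      ENNReal.ofReal p.1 • (ball (0 : ℂ) R).indicator g (Complex.polarCoord.symm p) =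
        (Ioo 0 R).indicator (fun _ => 1) p.1 * (ENNReal.ofReal p.1 * g (circleMap 0 p.1 p.2)) := by
    rintro ⟨ρ, θ⟩ ⟨hρ, -⟩
    have hρ' : 0 < ρ := hρ
    have h2 : Complex.polarCoord.symm (ρ, θ) = circleMap 0 ρ θ := by
      simp [Complex.polarCoord_symm_apply, circleMap, Complex.exp_mul_I]
    rw [h2]
    by_cases hR : ρ < R
    · rw [indicator_of_mem (by simpa [abs_of_pos hρ'] using hR),
        indicator_of_mem (show ρ ∈ Ioo 0 R from ⟨hρ', hR⟩)]
      simp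
    · rw [indicator_of_notMem (by simpa [abs_of_pos hρ'] using hR),
        indicator_of_notMem (fun h => hR h.2)]
      simp
  rw [Measure.prod_restrict, setLIntegral_congr_fun (measurableSet_Ioi.prod measurableSet_Ioo) h1,
    ← Measure.prod_restrict, lintegral_prod]
  · rw [← lintegral_indicator measurableSet_Ioi, ← lintegral_indicator measurableSet_Ioo]
    congr 1
    ext ρ
    by_cases hρ : ρ ∈ Ioo 0 R
    · rw [indicator_of_mem (show ρ ∈ Ioi 0 from hρ.1), indicator_of_mem hρ]
      simp only [indicator_of_mem hρ, one_mul]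
      exact lintegral_const_mul _ (hm.comp (measurable_const.prodMk measurable_id))
    · rw [indicator_of_notMem hρ]
      simp [indicator_of_notMem hρ]
  · refine (Measurable.mul ?_ (Measurable.mul ?_ hm)).aemeasurable
    · exact (measurable_const.indicator measurableSet_Ioo).comp measurable_fst
    · exact measurable_fst.ennreal_ofReal

theorem exists_circleIntegrable {f : ℂ → ℝ} (hf : Measurable f) {c : ℂ} {δ : ℝ} (hδ : 0 < δ)
    (hi : IntegrableOn f (ball c δ)) : ∃ ρ ∈ Ioo 0 δ, CircleIntegrable f c ρ := by
  have hg : Measurable fun z => ‖f (c + z)‖ₑ := (hf.comp (measurable_const_add c)).enorm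
  have h1 : ∫⁻ z in ball (0 : ℂ) δ, ‖f (c + z)‖ₑ < ⊤ := by
    have h2 := (measurePreserving_add_left volume c).setLIntegral_comp_preimage
      (measurableSet_ball (x := c) (ε := δ)) (f := fun z => ‖f z‖ₑ) hf.enorm
    have h3 : (fun x => c + x) ⁻¹' ball c δ = ball 0 δ := by
      ext z; simp
    rw [h3] at h2
    rw [h2]
    exact hi.2
  rw [lintegral_ball_polar hg] at h1
  have hm : Measurable fun ρ : ℝ => ENNReal.ofReal ρ *
      ∫⁻ θ in Ioo (-Real.pi) Real.pi, ‖f (c + circleMap 0 ρ θ)‖ₑ := by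
    refine Measurable.mul measurable_id.ennreal_ofReal (Measurable.lintegral_prod_right' ?_
      (f := fun p : ℝ × ℝ => ‖f (c + circleMap 0 p.1 p.2)‖ₑ))
    refine hg.comp (Continuous.measurable ?_)
    simp only [circleMap]
    fun_prop
  have h4 := ae_lt_top hm h1.ne
  have : (ae (volume.restrict (Ioo 0 δ))).NeBot := by
    rw [ae_neBot, Ne, Measure.restrict_eq_zero]
    simp [hδ]
  obtain ⟨ρ, hρ, hρ'⟩ := (h4.and (ae_restrict_mem measurableSet_Ioo)).exists
  refine ⟨ρ, hρ', ?_⟩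
  have h5 : ∫⁻ θ in Ioo (-Real.pi) Real.pi, ‖f (c + circleMap 0 ρ θ)‖ₑ < ⊤ := by
    by_contra h
    rw [not_lt_top_iff.mp h, ENNReal.mul_top (by simpa using hρ'.1)] at hρ
    exact lt_irrefl _ hρ
  have h6 : IntegrableOn (fun θ => f (circleMap c ρ θ)) (Ioo (-Real.pi) Real.pi) := by
    refine ⟨(hf.comp (by fun_prop)).aestronglyMeasurable, ?_⟩
    simpa [HasFiniteIntegral, circleMap] using h5
  have h7 : IntervalIntegrable (fun θ => f (circleMap c ρ θ)) volume (-Real.pi)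
      (-Real.pi + 2 * Real.pi) := by
    rw [intervalIntegrable_iff_integrableOn_Ioo_of_le (by linarith [Real.pi_pos]),
      show -Real.pi + 2 * Real.pi = Real.pi by ring]
    exact h6
  exact ((periodic_circleMap c ρ).comp f).intervalIntegrable (by positivity) h7 0 (2 * Real.pi)

theorem LowerSemicontinuous.exists_continuous_tendsto {X : Type*} [PseudoMetricSpace X]
    {f : X → ℝ} (hf : LowerSemicontinuous f) (hf0 : ∀ x, 0 ≤ f x) :
    ∃ g : ℕ → C(X, ℝ), (∀ n x, 0 ≤ g n x) ∧ (∀ n x, g n x ≤ f x) ∧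
      ∀ x, Tendsto (fun n => g n x) atTop (nhds (f x)) := by
  have hb : ∀ (n : ℕ) (x : X), BddBelow (range fun y => f y + n * dist x y) := fun n x =>
    ⟨0, by rintro _ ⟨y, rfl⟩; exact add_nonneg (hf0 y) (by positivity)⟩
  have hle : ∀ (n : ℕ) (x : X), ⨅ y, (f y + n * dist x y) ≤ f x := fun n x =>
    (ciInf_le (hb n x) x).trans (by simp)
  have hlip : ∀ n : ℕ, LipschitzWith n fun x => ⨅ y, (f y + n * dist x y) := by
    intro n
    refine LipschitzWith.of_le_add_mul _ fun x x' => ?_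
    have : Nonempty X := ⟨x⟩
    rw [← sub_le_iff_le_add]
    refine le_ciInf fun y => ?_
    rw [sub_le_iff_le_add]
    refine (ciInf_le (hb n x) y).trans ?_
    have h1 := mul_le_mul_of_nonneg_left (dist_triangle x x' y) (Nat.cast_nonneg (α := ℝ) n)
    simp only [NNReal.coe_natCast]
    linarith
  refine ⟨fun n => ⟨_, (hlip n).continuous⟩,
    fun n x => Real.iInf_nonneg fun y => add_nonneg (hf0 y) (by positivity), hle, fun x => ?_⟩
  rw [tendsto_order]
  refine ⟨fun c hc => ?_, fun c hc => Eventually.of_forall fun n => (hle n x).trans_lt hc⟩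
  have : Nonempty X := ⟨x⟩
  obtain ⟨c', hcc', hc'⟩ := exists_between hc
  obtain ⟨δ, hδ, hball⟩ := Metric.eventually_nhds_iff.mp (hf x c' hc')
  filter_upwards [eventually_ge_atTop ⌈c' / δ⌉₊] with n hn
  refine hcc'.trans_le (le_ciInf fun y => ?_)
  by_cases hy : dist y x < δ
  · exact (hball hy).le.trans (by simpa using by positivity)
  · have h1 : c' / δ ≤ n := Nat.ceil_le.mp hn
    rw [div_le_iff₀ hδ] at h1
    rw [not_lt, dist_comm] at hy
    have h2 := mul_le_mul_of_nonneg_left hy (Nat.cast_nonneg (α := ℝ) n)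
    linarith [hf0 y]

theorem exists_polynomial_re_near (G : C(AddCircle (2 * Real.pi), ℝ)) {δ : ℝ} (hδ : 0 < δ) :
    ∃ P : Polynomial ℂ, ∀ θ : ℝ, |(P.eval (exp (θ * I))).re - G θ| < δ := by
  have : Fact (0 < 2 * Real.pi) := ⟨Real.two_pi_pos⟩
  have hspan : ∀ f ∈ Submodule.span ℂ (range (@fourier (2 * Real.pi))),
      ∃ P Q : Polynomial ℂ, ∀ θ : ℝ,
        f θ = P.eval (exp (θ * I)) + (starRingEnd ℂ) (Q.eval (exp (θ * I))) := by
    intro f hf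
    induction hf using Submodule.span_induction with
    | mem f hf =>
      obtain ⟨n, rfl⟩ := hf
      have hexp : ∀ θ : ℝ, fourier (T := 2 * Real.pi) n θ = exp (n * (θ * I)) := by
        intro θ
        rw [fourier_coe_apply]
        congr 1
        have : (Real.pi : ℂ) ≠ 0 := by exact_mod_cast Real.pi_ne_zero
        push_cast
        field_simp
      rcases Int.eq_nat_or_neg n with ⟨m, rfl | rfl⟩
      · refine ⟨Polynomial.X ^ m, 0, fun θ => ?_⟩
        rw [hexp]
        simp [← Complex.exp_nat_mul]
      · refine ⟨0, Polynomial.X ^ m, fun θ => ?_⟩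
        rw [hexp]
        simp [← Complex.exp_nat_mul, ← Complex.exp_conj]
    | zero => exact ⟨0, 0, by simp⟩
    | add f g _ _ hf hg =>
      obtain ⟨P, Q, h⟩ := hf
      obtain ⟨P', Q', h'⟩ := hg
      refine ⟨P + P', Q + Q', fun θ => ?_⟩
      simp only [ContinuousMap.add_apply, h, h', Polynomial.eval_add, map_add]
      ring
    | smul c f _ hf =>
      obtain ⟨P, Q, h⟩ := hf
      refine ⟨Polynomial.C c * P, Polynomial.C ((starRingEnd ℂ) c) * Q, fun θ => ?_⟩
      simp only [ContinuousMap.smul_apply, h, Polynomial.eval_mul, Polynomial.eval_C, map_mul,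
        Complex.conj_conj, smul_eq_mul]
      ring
  let Gc : C(AddCircle (2 * Real.pi), ℂ) := ⟨fun x => (G x : ℂ), by fun_prop⟩
  have hG : Gc ∈ (Submodule.span ℂ (range (@fourier (2 * Real.pi)))).topologicalClosure := by
    rw [span_fourier_closure_eq_top]
    trivial
  obtain ⟨f, hf, hfG⟩ := Metric.mem_closure_iff.mp hG δ hδ
  obtain ⟨P, Q, h⟩ := hspan f hf
  refine ⟨P + Q, fun θ => ?_⟩
  have h1 := (ContinuousMap.dist_apply_le_dist (f := Gc) (g := f) (θ : AddCircle _)).trans_lt hfG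
  rw [dist_comm, dist_eq_norm, h] at h1
  refine lt_of_le_of_lt ?_ h1
  refine (congrArg abs ?_).trans_le (Complex.abs_re_le_norm _)
  simp [Gc]

theorem re_eval_zero_le_of_re_le_on_circle {w : ℂ → ℝ}
    (hlsc : LowerSemicontinuousOn w (ball 0 1))
    (hmean : ∀ z ∈ ball (0 : ℂ) 1, ∀ δ > 0, ∃ ρ ∈ Ioo 0 δ,
      CircleIntegrable w z ρ ∧ Real.circleAverage w z ρ ≤ w z)
    {α : ℂ} (hα : ‖α‖ < 1) {r : ℝ} (hr : r ∈ Ioo (0 : ℝ) 1) {f : ℂ → ℂ} (hf : Differentiable ℂ f)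
    (hle : ∀ u, ‖u‖ = r → (f u).re ≤ w (diskInvolution α u)) :
    (f 0).re ≤ w α := by
  have hsub : closedBall (0 : ℂ) r ⊆ ball 0 1 := closedBall_subset_ball hr.2
  have hbij := bijOn_diskInvolution hα
  set K := diskInvolution α '' closedBall 0 r
  have hKsub : K ⊆ ball 0 1 := (image_mono hsub).trans hbij.image_eq.subset
  have hKc : IsCompact K :=
    (isCompact_closedBall 0 r).image_of_continuousOn ((continuousOn_diskInvolution hα).mono hsub)
  have h0K : α ∈ K := ⟨0, by simpa using hr.1.le, by simp⟩
  refine le_of_forall_pos_le_add fun ε hε => ?_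
  let q : ℂ → ℝ := fun z => (f (diskInvolution α z)).re + ε * ‖z‖ ^ 2
  have hqc : ContinuousOn q (ball 0 1) := by
    refine ContinuousOn.add (Complex.continuous_re.comp_continuousOn
      (hf.continuous.comp_continuousOn (continuousOn_diskInvolution hα))) (by fun_prop)
  obtain ⟨z₀, ⟨u₀, hu₀, rfl⟩, hmin⟩ := LowerSemicontinuousOn.exists_isMinOn ⟨α, h0K⟩ hKc
    ((hlsc.mono hKsub).add (hqc.neg.mono hKsub).lowerSemicontinuousOn)
  rw [isMinOn_iff] at hmin
  have hu1 : ‖u₀‖ < 1 := by simpa using hsub hu₀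
  set z₀ := diskInvolution α u₀
  have hz1 : ‖z₀‖ < 1 := norm_diskInvolution_lt_one hα hu1
  have hinv : diskInvolution α z₀ = u₀ := diskInvolution_diskInvolution hα hu1
  rcases (mem_closedBall_zero_iff.mp hu₀).eq_or_lt with heq | hlt
  · have h1 := hle u₀ heq
    have h2 := hmin α h0K
    simp only [q, hinv, diskInvolution_self, Pi.neg_apply] at h2
    have h3 : 0 ≤ ε * ‖α‖ ^ 2 := by positivity
    have h4 : ε * ‖z₀‖ ^ 2 ≤ ε * 1 := by
      gcongr
      exact pow_le_one₀ (norm_nonneg _) hz1.le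
    linarith
  · exfalso
    have hz₀b : z₀ ∈ ball (0 : ℂ) 1 := by simpa using hz1
    have hev : ∀ᶠ z in nhds z₀, z ∈ K := by
      have h1 : ∀ᶠ z in nhds z₀, ‖diskInvolution α z‖ < r :=
        (differentiableAt_diskInvolution hα hz1.le).continuousAt.norm.eventually_lt
          continuousAt_const (by simpa [hinv] using hlt)
      filter_upwards [h1, isOpen_ball.mem_nhds hz₀b] with z h1 h2
      exact ⟨_, by simpa using h1.le, diskInvolution_diskInvolution hα (by simpa using h2)⟩
    obtain ⟨δ, hδ, hδK⟩ := Metric.eventually_nhds_iff_ball.mp hev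
    obtain ⟨ρ, hρ, hci, hav⟩ := hmean z₀ hz₀b δ hδ
    let Q : ℂ → ℂ := fun z => f (diskInvolution α z) +
      ε * (‖z₀‖ ^ 2 + 2 * (starRingEnd ℂ) z₀ * (z - z₀))
    have hclb : closedBall z₀ ρ ⊆ ball 0 1 := fun z hz =>
      hKsub (hδK z ((mem_closedBall.mp hz).trans_lt hρ.2))
    have hQd : DifferentiableOn ℂ Q (closedBall z₀ |ρ|) := by
      intro z hz
      rw [abs_of_pos hρ.1] at hz
      have hz' := (mem_ball_zero_iff.mp (hclb hz)).le
      refine DifferentiableAt.differentiableWithinAt (DifferentiableAt.add ?_ (by fun_prop))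
      exact (hf _).comp z (differentiableAt_diskInvolution hα hz')
    have hQci : CircleIntegrable Q z₀ ρ :=
      (hQd.continuousOn.mono sphere_subset_closedBall).circleIntegrable'
    have hQav : Real.circleAverage Q z₀ ρ = Q z₀ :=
      (hQd.diffContOnCl_ball subset_rfl).circleAverage
    have hRe : Real.circleAverage (fun z => (Q z).re) z₀ ρ = (Q z₀).re := by
      rw [← hQav]
      exact Complex.reCLM.circleAverage_comp_comm hQci
    have hqQ : ∀ z ∈ sphere z₀ |ρ|, q z = (Q z).re + ε * ρ ^ 2 := by
      intro z hz
      have h1 : ‖z - z₀‖ ^ 2 = ρ ^ 2 := by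
        rw [mem_sphere_iff_norm.mp hz, sq_abs]
      have h2 : ‖z‖ ^ 2 = ‖z₀‖ ^ 2 + 2 * ((starRingEnd ℂ) z₀ * (z - z₀)).re + ρ ^ 2 := by
        rw [← h1]
        simp only [← Complex.normSq_eq_norm_sq, Complex.normSq_apply, Complex.sub_re,
          Complex.sub_im, Complex.mul_re, Complex.conj_re, Complex.conj_im]
        ring
      have h3 : (Q z).re = (f (diskInvolution α z)).re +
          ε * (‖z₀‖ ^ 2 + 2 * ((starRingEnd ℂ) z₀ * (z - z₀)).re) := by
        simp only [Q, mul_assoc, Complex.add_re, Complex.re_ofReal_mul, ← Complex.ofReal_pow,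
          Complex.ofReal_re]
        simp
      simp only [q]
      rw [h2, h3]
      ring
    have hReci : CircleIntegrable (fun z => (Q z).re) z₀ ρ :=
      ((Complex.continuous_re.comp_continuousOn hQd.continuousOn).mono
        sphere_subset_closedBall).circleIntegrable'
    have hlow : ∀ z ∈ sphere z₀ |ρ|, w z₀ - q z₀ + ε * ρ ^ 2 + (Q z).re ≤ w z := by
      intro z hz
      have h1 := hmin z (hδK z (by
        rw [mem_ball, mem_sphere.mp hz, abs_of_pos hρ.1]; exact hρ.2))
      simp only [Pi.neg_apply] at h1
      linarith [hqQ z hz]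
    have hcc : CircleIntegrable (fun _ => w z₀ - q z₀ + ε * ρ ^ 2) z₀ ρ :=
      circleIntegrable_const _ _ _
    have h5 := Real.circleAverage_mono (hcc.add hReci) hci hlow
    have h6 := Real.circleAverage_add hcc hReci
    rw [h6, Real.circleAverage_const, hRe] at h5
    have h7 : (Q z₀).re = q z₀ := by
      simp [Q, q, ← Complex.ofReal_pow]
    have : 0 < ε * ρ ^ 2 := mul_pos hε (pow_pos hρ.1 2)
    linarith

theorem integral_le_of_le_on_circle {w : ℂ → ℝ}
    (hlsc : LowerSemicontinuousOn w (ball 0 1))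
    (hmean : ∀ z ∈ ball (0 : ℂ) 1, ∀ δ > 0, ∃ ρ ∈ Ioo 0 δ,
      CircleIntegrable w z ρ ∧ Real.circleAverage w z ρ ≤ w z)
    {α : ℂ} (hα : ‖α‖ < 1) {r : ℝ} (hr : r ∈ Ioo (0 : ℝ) 1) (G : C(AddCircle (2 * Real.pi), ℝ))
    (hle : ∀ θ : ℝ, G θ ≤ w (diskInvolution α (circleMap 0 r θ))) :
    ∫ θ in (0 : ℝ)..2 * Real.pi, G θ ≤ 2 * Real.pi * w α := by
  have hpi := Real.pi_pos
  refine le_of_forall_pos_le_add fun ε hε => ?_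
  set δ := ε / (4 * Real.pi) with hδ
  have hδ0 : 0 < δ := by positivity
  obtain ⟨P, hP⟩ := exists_polynomial_re_near G hδ0
  have hr0 : (r : ℂ) ≠ 0 := by exact_mod_cast hr.1.ne'
  have h1 := re_eval_zero_le_of_re_le_on_circle hlsc hmean hα hr
    (f := fun u => P.eval (u / r) - δ) ((P.differentiable.comp (by fun_prop)).sub_const _) (by
      intro u hu
      have hu' : u = circleMap 0 r u.arg := by
        simp only [circleMap, zero_add, ← hu, Complex.norm_mul_exp_arg_mul_I]
      have h2 := hle u.arg
      have h3 : u / r = exp (u.arg * I) := by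
        rw [div_eq_iff hr0]
        conv_lhs => rw [hu']
        simp [circleMap, mul_comm]
      rw [← hu'] at h2
      have h4 := (abs_lt.mp (hP u.arg)).2
      rw [h3, Complex.sub_re, Complex.ofReal_re]
      linarith)
  simp only [zero_div, Complex.sub_re, Complex.ofReal_re] at h1
  have hPc : Continuous fun z => P.eval z := P.continuous
  have h5 : Real.circleAverage (fun z => (P.eval z).re) 0 1 = (P.eval 0).re := by
    have h6 : Real.circleAverage (fun z => P.eval z) 0 1 = P.eval 0 :=
      P.differentiable.diffContOnCl.circleAverage
    rw [← h6]
    exact Complex.reCLM.circleAverage_comp_comm hPc.continuousOn.circleIntegrable'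
  rw [Real.circleAverage_def, smul_eq_mul, inv_mul_eq_iff_eq_mul₀ (by positivity)] at h5
  have hi1 : Continuous fun θ : ℝ => (P.eval (circleMap 0 1 θ)).re + δ := by fun_prop
  have hi2 : Continuous fun θ : ℝ => G θ :=
    G.continuous.comp (AddCircle.continuous_mk' (2 * Real.pi))
  have h7 : ∫ θ in (0 : ℝ)..2 * Real.pi, G θ ≤
      ∫ θ in (0 : ℝ)..2 * Real.pi, ((P.eval (circleMap 0 1 θ)).re + δ) := by
    refine intervalIntegral.integral_mono_on (by positivity) (hi2.intervalIntegrable _ _)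
      (hi1.intervalIntegrable _ _) fun θ _ => ?_
    have := (abs_lt.mp (hP θ)).1
    simp only [circleMap, zero_add, Complex.ofReal_one, one_mul]
    linarith
  rw [intervalIntegral.integral_add (Continuous.intervalIntegrable (by fun_prop) _ _)
    (by simp), h5] at h7
  simp only [intervalIntegral.integral_const, sub_zero, smul_eq_mul] at h7
  have h8 : 2 * Real.pi * δ = ε / 2 := by rw [hδ]; field_simp; ring
  nlinarith

theorem lintegral_circle_le {w : ℂ → ℝ} (hlsc : LowerSemicontinuousOn w (ball 0 1))
    (hw0 : ∀ z ∈ ball (0 : ℂ) 1, 0 ≤ w z)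
    (hmean : ∀ z ∈ ball (0 : ℂ) 1, ∀ δ > 0, ∃ ρ ∈ Ioo 0 δ,
      CircleIntegrable w z ρ ∧ Real.circleAverage w z ρ ≤ w z)
    {α : ℂ} (hα : ‖α‖ < 1) {r : ℝ} (hr : r ∈ Ioo (0 : ℝ) 1) :
    ∫⁻ θ in Ioo (-Real.pi) Real.pi,
      ENNReal.ofReal (w (diskInvolution α (circleMap 0 r θ))) ≤
        ENNReal.ofReal (2 * Real.pi * w α) := by
  have hpi := Real.pi_pos
  have : Fact (0 < 2 * Real.pi) := ⟨Real.two_pi_pos⟩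
  let c : AddCircle (2 * Real.pi) → ℂ := fun x => r * AddCircle.toCircle x
  have hc : Continuous c :=
    continuous_const.mul (continuous_subtype_val.comp AddCircle.continuous_toCircle)
  have hcb : ∀ x, c x ∈ ball (0 : ℂ) 1 := fun x => by
    simpa [c, abs_of_pos hr.1, Circle.norm_coe] using hr.2
  have hcθ : ∀ θ : ℝ, c θ = circleMap 0 r θ := fun θ => by
    simp [c, circleMap, AddCircle.toCircle_apply_mk, Circle.coe_exp]
  have hφ := bijOn_diskInvolution hα
  have hf : LowerSemicontinuous fun x => w (diskInvolution α (c x)) := by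
    rw [← lowerSemicontinuousOn_univ_iff]
    exact hlsc.comp ((continuousOn_diskInvolution hα).comp hc.continuousOn fun x _ => hcb x)
      fun x _ => hφ.mapsTo (hcb x)
  obtain ⟨g, hg0, hgle, hgt⟩ := hf.exists_continuous_tendsto fun x => hw0 _ (hφ.mapsTo (hcb x))
  have hgc : ∀ n, Continuous fun θ : ℝ => g n θ := fun n =>
    (g n).continuous.comp (AddCircle.continuous_mk' (2 * Real.pi))
  have hbound : ∀ n, ∫⁻ θ in Ioo (-Real.pi) Real.pi, ENNReal.ofReal (g n (θ : ℝ)) ≤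
      ENNReal.ofReal (2 * Real.pi * w α) := by
    intro n
    have h1 := integral_le_of_le_on_circle hlsc hmean hα hr (g n) fun θ => by
      simpa [hcθ] using hgle n θ
    have hper : Function.Periodic (fun θ : ℝ => g n θ) (2 * Real.pi) := fun θ => by simp
    have h2 := hper.intervalIntegral_add_eq 0 (-Real.pi)
    rw [zero_add, show -Real.pi + 2 * Real.pi = Real.pi by ring,
      intervalIntegral.integral_of_le (a := -Real.pi) (by linarith),
      integral_Ioc_eq_integral_Ioo] at h2
    rw [h2] at h1
    rw [← ofReal_integral_eq_lintegral_ofReal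
      (((hgc n).integrableOn_Icc (a := -Real.pi) (b := Real.pi)).mono_set Ioo_subset_Icc_self)
      (ae_of_all _ fun θ => hg0 n θ)]
    exact ENNReal.ofReal_le_ofReal h1
  calc ∫⁻ θ in Ioo (-Real.pi) Real.pi, ENNReal.ofReal (w (diskInvolution α (circleMap 0 r θ)))
      = ∫⁻ θ in Ioo (-Real.pi) Real.pi,
          liminf (fun n => ENNReal.ofReal (g n (θ : ℝ))) atTop := by
        congr 1
        ext θ
        rw [← hcθ]
        exact (ENNReal.tendsto_ofReal (hgt θ)).liminf_eq.symm
    _ ≤ liminf (fun n => ∫⁻ θ in Ioo (-Real.pi) Real.pi, ENNReal.ofReal (g n (θ : ℝ))) atTop :=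
        lintegral_liminf_le fun n => (hgc n).measurable.ennreal_ofReal
    _ ≤ ENNReal.ofReal (2 * Real.pi * w α) :=
        liminf_le_of_le (by isBoundedDefault) fun b hb => by
          obtain ⟨n, hn⟩ := hb.exists
          exact hn.trans (hbound n)

theorem lintegral_ball_comp_diskInvolution_le {w : ℂ → ℝ}
    (hlsc : LowerSemicontinuousOn w (ball 0 1)) (hw0 : ∀ z ∈ ball (0 : ℂ) 1, 0 ≤ w z)
    (hmean : ∀ z ∈ ball (0 : ℂ) 1, ∀ δ > 0, ∃ ρ ∈ Ioo 0 δ,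
      CircleIntegrable w z ρ ∧ Real.circleAverage w z ρ ≤ w z)
    {α : ℂ} (hα : ‖α‖ < 1) :
    ∫⁻ z in ball (0 : ℂ) 1, ENNReal.ofReal (w (diskInvolution α z)) ≤
      ENNReal.ofReal (2 * Real.pi * w α) := by
  have hm : Measurable ((ball (0 : ℂ) 1).indicator fun z => w (diskInvolution α z)) :=
    (hlsc.comp (continuousOn_diskInvolution hα)
      (bijOn_diskInvolution hα).mapsTo).measurable_indicator isOpen_ball
  calc ∫⁻ z in ball (0 : ℂ) 1, ENNReal.ofReal (w (diskInvolution α z))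
      = ∫⁻ z in ball (0 : ℂ) 1,
          ENNReal.ofReal ((ball (0 : ℂ) 1).indicator (fun z => w (diskInvolution α z)) z) :=
        setLIntegral_congr_fun measurableSet_ball fun z hz => by simp only [indicator_of_mem hz]
    _ ≤ ∫⁻ _ in Ioo (0 : ℝ) 1, ENNReal.ofReal (2 * Real.pi * w α) := by
        rw [lintegral_ball_polar hm.ennreal_ofReal]
        refine setLIntegral_mono measurable_const fun ρ hρ => ?_
        have hmem : ∀ θ, circleMap 0 ρ θ ∈ ball (0 : ℂ) 1 := fun θ => by
          simpa [abs_of_pos hρ.1] using hρ.2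
        simp only [indicator_of_mem (hmem _)]
        refine (mul_le_of_le_one_left' ?_).trans (lintegral_circle_le hlsc hw0 hmean hα hρ)
        exact ENNReal.ofReal_le_one.mpr hρ.2.le
    _ = ENNReal.ofReal (2 * Real.pi * w α) := by simp

theorem iteratedDeriv_div_factorial_eq_of_hasSum {f : ℂ → ℂ} {c : ℕ → ℂ}
    (h : ∀ z : ℂ, ‖z‖ < 1 → HasSum (fun n => c n * z ^ n) (f z)) (n : ℕ) :
    iteratedDeriv n f 0 / (n.factorial : ℂ) = c n := by
  have h1 : HasFPowerSeriesAt f (FormalMultilinearSeries.ofScalars ℂ c) 0 := by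
    rw [hasFPowerSeriesAt_iff]
    filter_upwards [isOpen_ball.mem_nhds (mem_ball_self one_pos)] with z hz
    simpa [mul_comm] using h z (by simpa using hz)
  have h2 := h1.analyticAt.hasFPowerSeriesAt
  simpa using congr_arg (FormalMultilinearSeries.coeff · n) (h2.eq_formalMultilinearSeries h1)

/-- The Taylor coefficients at `0` of `diskInvolution α * (a - diskInvolution α)`. -/
noncomputable def diskInvolutionCoeff (α a : ℂ) : ℕ → ℂ
  | 0 => α * (a - α)
  | n + 1 => (1 - (starRingEnd ℂ) α * α) * (2 * α - a) * (starRingEnd ℂ) α ^ n -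
      (1 - (starRingEnd ℂ) α * α) ^ 2 * (n * (starRingEnd ℂ) α ^ (n - 1))

theorem hasSum_diskInvolution_mul_sub {α z : ℂ} (a : ℂ) (hα : ‖α‖ < 1) (hz : ‖z‖ < 1) :
    HasSum (fun n => diskInvolutionCoeff α a n * z ^ n)
      (diskInvolution α z * (a - diskInvolution α z)) := by
  have h0 := one_sub_conj_mul_ne_zero hα hz.le
  rw [← hasSum_nat_add_iff' 1, diskInvolution]
  simp only [diskInvolutionCoeff, Finset.sum_range_one, pow_zero, mul_one]
  set b := (starRingEnd ℂ) α with hb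
  have hbz : ‖b * z‖ < 1 := by
    rw [norm_mul, hb, RCLike.norm_conj]
    nlinarith [norm_nonneg α, norm_nonneg z]
  have h1 := (hasSum_geometric_of_norm_lt_one hbz).mul_left ((1 - b * α) * (2 * α - a) * z)
  have h2 : HasSum (fun n : ℕ => (n : ℂ) * b ^ (n - 1) * z ^ (n + 1))
      (z ^ 2 * (1 / (1 - b * z) ^ 2)) := by
    rw [← hasSum_nat_add_iff' 1]
    have h3 := (hasSum_choose_mul_geometric_of_norm_lt_one 1 hbz).mul_left (z ^ 2)
    simp only [Finset.sum_range_one, Nat.cast_zero, zero_mul, sub_zero]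
    refine h3.congr_fun fun n => ?_
    simp only [Nat.choose_one_right, Nat.add_sub_cancel]
    ring
  have h4 := h1.sub (h2.mul_left ((1 - b * α) ^ 2))
  have h5 : (α - z) / (1 - b * z) * (a - (α - z) / (1 - b * z)) - α * (a - α) =
      (1 - b * α) * (2 * α - a) * z * (1 - b * z)⁻¹ -
        (1 - b * α) ^ 2 * (z ^ 2 * (1 / (1 - b * z) ^ 2)) := by
    have e : (1 - b * z) * (1 - b * z)⁻¹ = 1 := mul_inv_cancel₀ h0
    have h6 : (α - z) / (1 - b * z) = α - (1 - b * α) * z * (1 - b * z)⁻¹ := by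
      rw [div_eq_mul_inv]
      linear_combination α * e
    rw [h6, one_div, ← inv_pow]
    ring
  rw [h5]
  refine h4.congr_fun fun n => ?_
  ring

theorem norm_diskInvolutionCoeff_succ_sq_le {α a : ℂ} (hα : ‖α‖ < 1) (ha : ‖a‖ = 1) (n : ℕ) :
    ‖diskInvolutionCoeff α a (n + 1)‖ ^ 2 ≤ 18 * (1 - ‖α‖ ^ 2) ^ 2 * (‖α‖ ^ 2) ^ n +
      4 * (1 - ‖α‖ ^ 2) ^ 4 * (((n + 1).choose 2 : ℝ) * (‖α‖ ^ 2) ^ (n - 1)) := by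
  set r := ‖α‖ with hr
  have hr0 : 0 ≤ r := norm_nonneg α
  have hs : 0 < 1 - r ^ 2 := by nlinarith
  have hbα : ‖1 - (starRingEnd ℂ) α * α‖ = 1 - r ^ 2 := by
    rw [← Complex.normSq_eq_conj_mul_self, Complex.normSq_eq_norm_sq, ← hr, ← Complex.ofReal_one,
      ← Complex.ofReal_sub, Complex.norm_real, Real.norm_of_nonneg hs.le]
  have h1 : ‖2 * α - a‖ ≤ 3 := by
    refine (norm_sub_le _ _).trans ?_
    rw [norm_mul, ha, ← hr, RCLike.norm_ofNat]
    linarith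
  have h2 := norm_sub_le
    ((1 - (starRingEnd ℂ) α * α) * (2 * α - a) * (starRingEnd ℂ) α ^ n)
    ((1 - (starRingEnd ℂ) α * α) ^ 2 * (n * (starRingEnd ℂ) α ^ (n - 1)))
  rw [norm_mul, norm_mul, norm_mul (_ ^ 2), norm_mul (n : ℂ), norm_pow, norm_pow, norm_pow, hbα,
    RCLike.norm_conj, RCLike.norm_natCast, ← hr] at h2
  have h3 : (1 - r ^ 2) * ‖2 * α - a‖ * r ^ n ≤ (1 - r ^ 2) * 3 * r ^ n := by gcongr
  have h4 : (n : ℝ) ^ 2 ≤ 2 * ((n + 1).choose 2 : ℝ) := by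
    rw [Nat.cast_choose_two]
    push_cast
    nlinarith [Nat.cast_nonneg (α := ℝ) n]
  have h5 := mul_le_mul_of_nonneg_right h4
    (show 0 ≤ 2 * (1 - r ^ 2) ^ 4 * (r ^ (n - 1)) ^ 2 by positivity)
  rw [diskInvolutionCoeff, pow_right_comm r 2 n, pow_right_comm r 2 (n - 1)]
  refine (pow_le_pow_left₀ (norm_nonneg _) (h2.trans (add_le_add_left h3 _)) 2).trans ?_
  linarith [sq_nonneg ((1 - r ^ 2) * 3 * r ^ n - (1 - r ^ 2) ^ 2 * (n * r ^ (n - 1)))]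

theorem hardyNormSq_diskInvolution_mul_sub_le {α a : ℂ} (hα : ‖α‖ < 1) (ha : ‖a‖ = 1) :
    hardyNormSq (fun z => diskInvolution α z * (a - diskInvolution α z)) ≤
      ‖a - α‖ ^ 2 + 22 * (1 - ‖α‖ ^ 2) := by
  have hs : 1 - ‖α‖ ^ 2 ≠ 0 := by nlinarith [norm_nonneg α]
  have ht : ‖‖α‖ ^ 2‖ < 1 := by
    rw [Real.norm_of_nonneg (by positivity)]
    nlinarith [norm_nonneg α]
  have hE : HasSum (fun n : ℕ => ((n + 1).choose 2 : ℝ) * (‖α‖ ^ 2) ^ (n - 1))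
      (1 / (1 - ‖α‖ ^ 2) ^ 3) := by
    rw [← hasSum_nat_add_iff' 1]
    have h := hasSum_choose_mul_geometric_of_norm_lt_one 2 ht
    simp only [Finset.sum_range_one, zero_add, Nat.choose_succ_self,
      Nat.cast_zero, zero_mul, sub_zero, Nat.add_sub_cancel]
    exact h
  have hD := ((hasSum_geometric_of_norm_lt_one ht).mul_left (18 * (1 - ‖α‖ ^ 2) ^ 2)).add
      (hE.mul_left (4 * (1 - ‖α‖ ^ 2) ^ 4))
  have hle := norm_diskInvolutionCoeff_succ_sq_le hα ha
  have hsum : Summable fun n => ‖diskInvolutionCoeff α a (n + 1)‖ ^ 2 :=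
    Summable.of_nonneg_of_le (fun _ => sq_nonneg _) hle hD.summable
  have hcoeff : hardyNormSq (fun z => diskInvolution α z * (a - diskInvolution α z)) =
      ∑' n, ‖diskInvolutionCoeff α a n‖ ^ 2 :=
    tsum_congr fun n => by
      rw [iteratedDeriv_div_factorial_eq_of_hasSum fun z hz =>
        hasSum_diskInvolution_mul_sub a hα hz]
  have hsum' : Summable fun n => ‖diskInvolutionCoeff α a n‖ ^ 2 :=
    (summable_nat_add_iff (f := fun n => ‖diskInvolutionCoeff α a n‖ ^ 2) 1).mp hsum
  rw [hcoeff, hsum'.tsum_eq_zero_add]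
  have h1 : ‖diskInvolutionCoeff α a 0‖ ^ 2 ≤ ‖a - α‖ ^ 2 := by
    rw [diskInvolutionCoeff, norm_mul, mul_pow]
    exact mul_le_of_le_one_left (by positivity) (pow_le_one₀ (norm_nonneg _) hα.le)
  have h2 : ∑' n, ‖diskInvolutionCoeff α a (n + 1)‖ ^ 2 ≤ _ :=
    (hsum.tsum_le_tsum hle hD.summable).trans_eq hD.tsum_eq
  have h3 : 18 * (1 - ‖α‖ ^ 2) ^ 2 * (1 - ‖α‖ ^ 2)⁻¹ +
      4 * (1 - ‖α‖ ^ 2) ^ 4 * (1 / (1 - ‖α‖ ^ 2) ^ 3) = 22 * (1 - ‖α‖ ^ 2) := by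
    field_simp
    ring
  exact add_le_add h1 (h2.trans_eq h3)

theorem SuperharmonicOnDisk.exists_circleAverage_le {w : ℂ → ℝ} (hw : SuperharmonicOnDisk w)
    {z : ℂ} (hz : z ∈ ball (0 : ℂ) 1) (hi : IntegrableAtFilter w (nhdsWithin z (ball 0 1)))
    {δ : ℝ} (hδ : 0 < δ) :
    ∃ ρ ∈ Ioo 0 δ, CircleIntegrable w z ρ ∧ Real.circleAverage w z ρ ≤ w z := by
  rw [isOpen_ball.nhdsWithin_eq hz] at hi
  obtain ⟨s, hs, hsi⟩ := hi
  obtain ⟨ε, hε, hεs⟩ := Metric.mem_nhds_iff.mp (inter_mem hs (isOpen_ball.mem_nhds hz))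
  have hsub : ball z (min δ ε) ⊆ s ∩ ball 0 1 :=
    (ball_subset_ball (min_le_right _ _)).trans hεs
  have heq : EqOn ((ball (0 : ℂ) 1).indicator w) w (ball z (min δ ε)) := fun x hx =>
    indicator_of_mem (hsub hx).2 w
  have hsub' : ∀ {ρ}, ρ < min δ ε → closedBall z ρ ⊆ ball z (min δ ε) := fun h =>
    closedBall_subset_ball h
  obtain ⟨ρ, ⟨hρ0, hρ⟩, hc⟩ := exists_circleIntegrable
    (hw.1.measurable_indicator isOpen_ball) (lt_min hδ hε)
    ((integrableOn_congr_fun heq measurableSet_ball).mpr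
      (hsi.mono_set (hsub.trans inter_subset_left)))
  refine ⟨ρ, ⟨hρ0, hρ.trans_le (min_le_left _ _)⟩, ?_, ?_⟩
  · have h : (fun θ => (ball (0 : ℂ) 1).indicator w (circleMap z ρ θ)) =
        fun θ => w (circleMap z ρ θ) := funext fun θ =>
      heq (hsub' hρ (circleMap_mem_closedBall z hρ0.le θ))
    rwa [CircleIntegrable, h] at hc
  · have h := hw.2 z hz ρ hρ0 ((hsub' hρ).trans (hsub.trans inter_subset_right))
    simpa [Real.circleAverage_def, circleMap] using h

theorem deriv_diskInvolution_mul_sub {α z : ℂ} (a : ℂ) (hα : ‖α‖ < 1) (hz : ‖z‖ < 1) :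
    deriv (fun t => diskInvolution α t * (a - diskInvolution α t)) z =
      (a - 2 * diskInvolution α z) * deriv (diskInvolution α) z := by
  have h := (differentiableAt_diskInvolution hα hz.le).hasDerivAt
  refine (h.mul (h.const_sub a)).deriv.trans ?_
  ring

theorem setIntegral_deriv_diskInvolution_mul_sub_le {w : ℂ → ℝ} {α a : ℂ}
    (hwpos : ∀ z ∈ ball (0 : ℂ) 1, 0 < w z) (hw : SuperharmonicOnDisk w)
    (hi : LocallyIntegrableOn w (ball 0 1)) (hα : ‖α‖ < 1) (ha : ‖a‖ = 1) :
    ∫ z in ball (0 : ℂ) 1,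
      ‖deriv (fun t => diskInvolution α t * (a - diskInvolution α t)) z‖ ^ 2 * w z ≤
        18 * Real.pi * w α := by
  have hwα : 0 < w α := hwpos α (by simpa using hα)
  have hle := lintegral_ball_comp_diskInvolution_le hw.1 (fun z hz => (hwpos z hz).le)
    (fun z hz δ hδ => hw.exists_circleAverage_le hz (hi z hz) hδ) hα
  rw [← lintegral_ball_deriv_sq_mul hα fun z => ENNReal.ofReal (w z)] at hle
  have hle' : ∫⁻ z in ball (0 : ℂ) 1, ENNReal.ofReal
      ‖‖deriv (fun t => diskInvolution α t * (a - diskInvolution α t)) z‖ ^ 2 * w z‖ ≤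
      ENNReal.ofReal (18 * Real.pi * w α) := by
    calc
      _ ≤ ∫⁻ z in ball (0 : ℂ) 1, ENNReal.ofReal 9 *
          (ENNReal.ofReal (‖deriv (diskInvolution α) z‖ ^ 2) * ENNReal.ofReal (w z)) := by
        refine setLIntegral_mono' measurableSet_ball fun z hz => ?_
        have hz' : ‖z‖ < 1 := by simpa using hz
        have h1 : ‖a - 2 * diskInvolution α z‖ ≤ 3 := by
          refine (norm_sub_le _ _).trans ?_
          rw [norm_mul, ha, RCLike.norm_ofNat]
          linarith [norm_diskInvolution_lt_one hα hz']
        have h2 : ‖a - 2 * diskInvolution α z‖ ^ 2 ≤ 9 := by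
          nlinarith [norm_nonneg (a - 2 * diskInvolution α z)]
        rw [← ENNReal.ofReal_mul (by positivity), ← ENNReal.ofReal_mul (by positivity),
          Real.norm_of_nonneg (mul_nonneg (sq_nonneg _) (hwpos z hz).le),
          deriv_diskInvolution_mul_sub a hα hz', norm_mul, mul_pow, mul_assoc]
        exact ENNReal.ofReal_le_ofReal (mul_le_mul_of_nonneg_right h2
          (mul_nonneg (sq_nonneg _) (hwpos z hz).le))
      _ = ENNReal.ofReal 9 * ∫⁻ z in ball (0 : ℂ) 1,
          ENNReal.ofReal (‖deriv (diskInvolution α) z‖ ^ 2) * ENNReal.ofReal (w z) :=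
        lintegral_const_mul' _ _ ENNReal.ofReal_ne_top
      _ ≤ ENNReal.ofReal 9 * ENNReal.ofReal (2 * Real.pi * w α) := by gcongr
      _ = ENNReal.ofReal (18 * Real.pi * w α) := by
        rw [← ENNReal.ofReal_mul (by norm_num)]
        ring_nf
  exact (le_abs_self _).trans ((norm_integral_le_lintegral_norm _).trans
    (ENNReal.toReal_le_of_le_ofReal (by positivity) hle'))

theorem setIntegral_deriv_diskInvolution_mul_sub_eq_zero {w : ℂ → ℝ} {α a p : ℂ}
    (hw : SuperharmonicOnDisk w) (hα : ‖α‖ < 1) (hp : p ∈ ball (0 : ℂ) 1)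
    (hi : ¬ IntegrableAtFilter w (nhdsWithin p (ball 0 1)))
    (hne : a - 2 * diskInvolution α p ≠ 0) :
    ∫ z in ball (0 : ℂ) 1,
      ‖deriv (fun t => diskInvolution α t * (a - diskInvolution α t)) z‖ ^ 2 * w z = 0 := by
  refine integral_undef fun h => hi ?_
  set F : ℂ → ℂ := fun t => diskInvolution α t * (a - diskInvolution α t) with hF
  have hp' : ‖p‖ < 1 := by simpa using hp
  have hd : DifferentiableOn ℂ F (ball 0 1) := fun z hz => by
    have := differentiableAt_diskInvolution hα (z := z) (by simpa using hz.out.le)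
    exact (this.mul (this.const_sub a)).differentiableWithinAt
  have hc : ContinuousAt (fun z => ‖deriv F z‖ ^ 2) p :=
    ((hd.deriv isOpen_ball).continuousOn.continuousAt (isOpen_ball.mem_nhds hp)).norm.pow 2
  have h0 : 0 < ‖deriv F p‖ ^ 2 := by
    rw [deriv_diskInvolution_mul_sub a hα hp']
    have := mul_ne_zero hne (deriv_diskInvolution_ne_zero hα hp')
    positivity
  have hev := hc.eventually (lt_mem_nhds (half_lt_self h0))
  set m := ‖deriv F p‖ ^ 2 / 2
  have hm0 : 0 < m := half_pos h0
  rw [isOpen_ball.nhdsWithin_eq hp]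
  obtain ⟨ε, hε, hεs⟩ := Metric.mem_nhds_iff.mp (inter_mem hev (isOpen_ball.mem_nhds hp))
  refine ⟨ball p ε, ball_mem_nhds p hε, ?_⟩
  have hsub : ball p ε ⊆ ball 0 1 := fun x hx => (hεs hx).2
  have hmeas : AEStronglyMeasurable w (volume.restrict (ball p ε)) := by
    refine ((hw.1.measurable_indicator isOpen_ball).aestronglyMeasurable).congr ?_
    filter_upwards [ae_restrict_mem measurableSet_ball] with x hx
    exact indicator_of_mem (hsub hx) w
  refine ((IntegrableOn.mono_set h hsub).norm.const_mul m⁻¹).mono' hmeas ?_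
  filter_upwards [ae_restrict_mem measurableSet_ball] with x hx
  have hx1 : m < ‖deriv F x‖ ^ 2 := (hεs hx).1
  rw [norm_mul, Real.norm_of_nonneg (sq_nonneg _), ← div_eq_inv_mul, le_div_iff₀ hm0, mul_comm]
  exact mul_le_mul_of_nonneg_right hx1.le (norm_nonneg _)

theorem exists_tendsto_boundary_of_sInf_eq_zero {w : ℂ → ℝ}
    (hwpos : ∀ z ∈ ball (0 : ℂ) 1, 0 < w z) (hlsc : LowerSemicontinuousOn w (ball 0 1))
    (hinf : sInf (w '' ball 0 1) = 0) :
    ∃ a : ℂ, ‖a‖ = 1 ∧ ∃ x : ℕ → ℂ, (∀ n, x n ∈ ball (0 : ℂ) 1) ∧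
      Tendsto x atTop (nhds a) ∧ Tendsto (fun n => w (x n)) atTop (nhds 0) := by
  have hne : (w '' ball (0 : ℂ) 1).Nonempty := ⟨w 0, mem_image_of_mem w (mem_ball_self one_pos)⟩
  have hex : ∀ n : ℕ, ∃ x ∈ ball (0 : ℂ) 1, w x < 1 / ((n : ℝ) + 1) := fun n => by
    obtain ⟨_, ⟨x, hx, rfl⟩, h⟩ := exists_lt_of_csInf_lt hne
      (hinf.trans_lt (Nat.one_div_pos_of_nat (α := ℝ) (n := n)))
    exact ⟨x, hx, h⟩
  choose y hy hwy using hex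
  have hwy0 : Tendsto (fun n => w (y n)) atTop (nhds 0) :=
    squeeze_zero (fun n => (hwpos _ (hy n)).le) (fun n => (hwy n).le)
      tendsto_one_div_add_atTop_nhds_zero_nat
  obtain ⟨a, ha, k, hk, hka⟩ := (isCompact_closedBall (0 : ℂ) 1).tendsto_subseq
    fun n => ball_subset_closedBall (hy n)
  have hwk := hwy0.comp hk.tendsto_atTop
  refine ⟨a, ?_, y ∘ k, fun n => hy _, hka, hwk⟩
  have ha1 : ‖a‖ ≤ 1 := by simpa using ha
  by_contra hne1
  have hab : a ∈ ball (0 : ℂ) 1 := by simpa using lt_of_le_of_ne ha1 hne1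
  have h1 := hlsc a hab (w a / 2) (half_lt_self (hwpos a hab))
  rw [isOpen_ball.nhdsWithin_eq hab] at h1
  have h2 := hka.eventually h1
  have h3 := hwk.eventually (gt_mem_nhds (half_pos (hwpos a hab)))
  obtain ⟨n, hn, hn'⟩ := (h2.and h3).exists
  exact lt_asymm hn hn'

theorem eventually_sub_two_mul_diskInvolution_ne_zero {a p : ℂ} (ha : ‖a‖ = 1) (hp : ‖p‖ < 1)
    {x : ℕ → ℂ} (hx : Tendsto x atTop (nhds a)) :
    ∀ᶠ n in atTop, a - 2 * diskInvolution (x n) p ≠ 0 := by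
  have ha0 : a ≠ 0 := by
    rintro rfl
    simp at ha
  have hden : 1 - (starRingEnd ℂ) a * p ≠ 0 := fun h => by
    have := congr_arg norm (sub_eq_zero.mp h)
    rw [norm_mul, RCLike.norm_conj, ha, norm_one, one_mul] at this
    exact hp.ne' this
  have hconj : (starRingEnd ℂ) a * a = 1 := by
    rw [← Complex.normSq_eq_conj_mul_self, Complex.normSq_eq_norm_sq, ha]
    simp
  have hval : (a - p) / (1 - (starRingEnd ℂ) a * p) = a := by
    rw [div_eq_iff hden]
    linear_combination p * hconj
  have hlim : Tendsto (fun n => a - 2 * diskInvolution (x n) p) atTop (nhds (a - 2 * a)) := by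
    have h := (hx.sub_const p).div
      (((Complex.continuous_conj.tendsto a).comp hx).mul_const p |>.const_sub 1) hden
    rw [hval] at h
    exact (h.const_mul 2).const_sub a
  refine hlim.eventually_ne ?_
  rw [show a - 2 * a = -a by ring]
  exact neg_ne_zero.mpr ha0

/-- If `w` is a positive superharmonic weight on `𝔻` with `inf_𝔻 w = 0`, then
there are a point `a` of modulus `1` and a sequence `aₙ → a` in `𝔻` such that,
with `h(z) = z(a − z)` and the automorphisms `φₙ(z) = (aₙ − z)/(1 − conj(aₙ)z)`
of `𝔻`, one has `‖h∘φₙ‖²_{𝒟_w} = ‖h∘φₙ‖²_{H²} + D_w(h∘φₙ) → 0`; moreover `h`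
is bounded, non-constant and vanishes at `0`. -/
theorem exists_sequence_norm_tendsto_zero (w : ℂ → ℝ)
    (hwpos : ∀ z ∈ Metric.ball (0 : ℂ) 1, 0 < w z)
    (hwsh : SuperharmonicOnDisk w)
    (hinf : sInf (w '' Metric.ball 0 1) = 0) :
    ∃ a : ℂ, ‖a‖ = 1 ∧
      ∃ aa : ℕ → ℂ, (∀ n, aa n ∈ Metric.ball (0 : ℂ) 1) ∧
        Filter.Tendsto aa Filter.atTop (nhds a) ∧
        ∀ (h : ℂ → ℂ), h = (fun z => z * (a - z)) →
        ∀ (φ : ℕ → ℂ → ℂ),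
          φ = (fun n z => (aa n - z) / (1 - (starRingEnd ℂ) (aa n) * z)) →
          (∃ C : ℝ, ∀ z ∈ Metric.ball (0 : ℂ) 1, ‖h z‖ ≤ C) ∧
          (¬ ∃ c : ℂ, ∀ z ∈ Metric.ball (0 : ℂ) 1, h z = c) ∧
          h 0 = 0 ∧
          (∀ n, DifferentiableOn ℂ (φ n) (Metric.ball 0 1) ∧
            Set.BijOn (φ n) (Metric.ball 0 1) (Metric.ball 0 1)) ∧
          Filter.Tendsto
            (fun n => hardyNormSq (fun z => h (φ n z)) +
              (1 / Real.pi) * ∫ z in Metric.ball (0 : ℂ) 1,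
                ‖deriv (fun t => h (φ n t)) z‖ ^ 2 * w z)
            Filter.atTop (nhds 0) := by
  obtain ⟨a, ha, x, hx, hxa, hwx⟩ := exists_tendsto_boundary_of_sInf_eq_zero hwpos hwsh.1 hinf
  have hx' : ∀ n, ‖x n‖ < 1 := fun n => by simpa using hx n
  refine ⟨a, ha, x, hx, hxa, ?_⟩
  rintro h rfl φ rfl
  refine ⟨⟨2, fun z hz => ?_⟩, ?_, by simp, fun n => ⟨fun z hz => ?_, bijOn_diskInvolution (hx' n)⟩,
    ?_⟩
  · have hz' : ‖z‖ < 1 := by simpa using hz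
    rw [norm_mul]
    have := norm_sub_le a z
    nlinarith [norm_nonneg z, norm_nonneg (a - z)]
  · rintro ⟨c, hc⟩
    have h0 : 0 * (a - 0) = c := hc 0 (mem_ball_self one_pos)
    have h1 : a / 2 * (a - a / 2) = c := hc (a / 2) (by simp [ha]; norm_num)
    have ha0 : a ≠ 0 := by
      rintro rfl
      simp at ha
    refine mul_ne_zero (div_ne_zero ha0 two_ne_zero) (div_ne_zero ha0 two_ne_zero) ?_
    rw [zero_mul] at h0
    rw [h0, ← h1]
    ring
  · exact (differentiableAt_diskInvolution (hx' n)
      (mem_ball_zero_iff.mp hz).le).differentiableWithinAt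
  · change Tendsto (fun n => hardyNormSq (fun z => diskInvolution (x n) z *
        (a - diskInvolution (x n) z)) + (1 / Real.pi) * ∫ z in ball (0 : ℂ) 1,
      ‖deriv (fun t => diskInvolution (x n) t * (a - diskInvolution (x n) t)) z‖ ^ 2 * w z)
        atTop (nhds 0)
    have hint : ∀ᶠ n in atTop, ∫ z in ball (0 : ℂ) 1,
        ‖deriv (fun t => diskInvolution (x n) t * (a - diskInvolution (x n) t)) z‖ ^ 2 * w z ≤
          18 * Real.pi * w (x n) := by
      by_cases hi : LocallyIntegrableOn w (ball 0 1)
      · exact Eventually.of_forall fun n =>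
          setIntegral_deriv_diskInvolution_mul_sub_le hwpos hwsh hi (hx' n) ha
      · obtain ⟨p, hp, hpi⟩ : ∃ p ∈ ball (0 : ℂ) 1,
            ¬ IntegrableAtFilter w (nhdsWithin p (ball 0 1)) := by
          simpa [LocallyIntegrableOn] using hi
        filter_upwards [eventually_sub_two_mul_diskInvolution_ne_zero ha
          (mem_ball_zero_iff.mp hp) hxa] with n hn
        rw [setIntegral_deriv_diskInvolution_mul_sub_eq_zero hwsh (hx' n) hp hpi hn]
        have := hwpos _ (hx n)
        positivity
    have hlim : Tendsto (fun n => ‖a - x n‖ ^ 2 + 22 * (1 - ‖x n‖ ^ 2) +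
        (1 / Real.pi) * (18 * Real.pi * w (x n))) atTop (nhds 0) := by
      have h := (((hxa.const_sub a).norm.pow 2).add (((hxa.norm.pow 2).const_sub 1).const_mul
        22)).add ((hwx.const_mul (18 * Real.pi)).const_mul (1 / Real.pi))
      simpa [ha] using h
    refine squeeze_zero' (Eventually.of_forall fun n => ?_) ?_ hlim
    · exact add_nonneg (tsum_nonneg fun _ => sq_nonneg _) (mul_nonneg (by positivity)
        (setIntegral_nonneg measurableSet_ball fun z hz =>
          mul_nonneg (sq_nonneg _) (hwpos z hz).le))
    · filter_upwards [hint] with n hn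
      exact add_le_add (hardyNormSq_diskInvolution_mul_sub_le (hx' n) ha)
        (mul_le_mul_of_nonneg_left hn (by positivity))
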